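/- arXiv:0912.1638 — 2 statements merged into one kernel-verified Lean document; each statement's English description precedes it below -/
import Mathlib

section
/- Let S ⊆ (ℂˣ)ⁿ be a subset containing the identity (1,…,1) which is irreducible and closed in the Zariski topology of (ℂˣ)ⁿ, and suppose S ⊆ exp(𝔥) for some ℂ-linear subspace 𝔥 ⊆ ℂⁿ, where exp: ℂⁿ → (ℂˣ)ⁿ is the coordinatewise complex exponential. Then the subgroup of (ℂˣ)ⁿ generated by S is closed in the Zariski topology of (ℂˣ)ⁿ and is contained in exp(𝔥); in particular the smallest Zariski-closed subgroup of (ℂˣ)ⁿ containing S equals the subgroup generated by S and is contained in exp(𝔥). -/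
/-!
STATEMENT 1. Let `S ⊆ (ℂˣ)ⁿ` contain the identity, be irreducible and closed in the
Zariski topology of `(ℂˣ)ⁿ`, and suppose `S ⊆ exp(𝔥)` for a `ℂ`-linear subspace
`𝔥 ⊆ ℂⁿ` (`exp` the coordinatewise complex exponential). Then the subgroup of `(ℂˣ)ⁿ`
generated by `S` is Zariski closed and contained in `exp(𝔥)`; in particular the
smallest Zariski-closed subgroup containing `S` equals the subgroup generated by `S`.
-/

open MvPolynomial

/-- The Zariski topology on `ℂⁿ`: it is generated by the basic open sets
`D(p) = {v | p(v) ≠ 0}`, so its closed sets are exactly the common zero loci of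
sets of polynomials in `n` complex variables. -/
def zariskiC (n : ℕ) : TopologicalSpace (Fin n → ℂ) :=
  TopologicalSpace.generateFrom
    { U | ∃ p : MvPolynomial (Fin n) ℂ, U = { v | eval v p ≠ 0 } }

/-- The inclusion of the algebraic torus `(ℂˣ)ⁿ` into `ℂⁿ`. -/
def torusEmb (n : ℕ) : (Fin n → ℂˣ) → (Fin n → ℂ) := fun u i => (u i : ℂ)

/-- The Zariski topology on the torus `(ℂˣ)ⁿ`: the subspace topology induced from the
Zariski topology of `ℂⁿ`. -/
def torusTop (n : ℕ) : TopologicalSpace (Fin n → ℂˣ) :=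
  TopologicalSpace.induced (torusEmb n) (zariskiC n)

/-- The coordinatewise complex exponential `exp : ℂⁿ → (ℂˣ)ⁿ`. -/
noncomputable def expTorus (n : ℕ) : (Fin n → ℂ) → (Fin n → ℂˣ) :=
  fun z i => Units.mk0 (Complex.exp (z i)) (Complex.exp_ne_zero (z i))

open scoped Pointwise Topology

section Group

variable {G : Type*} [TopologicalSpace G] [CommGroup G]

/-- In a group with separately continuous multiplication, the product of two irreducible sets is
irreducible. -/
theorem IsIrreducible.mul_of_separatelyContinuousMul [SeparatelyContinuousMul G] {A B : Set G}
    (hA : IsIrreducible A) (hB : IsIrreducible B) : IsIrreducible (A * B) := by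
  refine ⟨hA.nonempty.mul hB.nonempty, ?_⟩
  have hA' := isPreirreducible_iff_isClosed_union_isClosed.1 hA.2
  rw [isPreirreducible_iff_isClosed_union_isClosed]
  intro Z₁ Z₂ h₁ h₂ h
  have hslice : ∀ Z : Set G, IsClosed Z → IsClosed {a : G | ∀ b ∈ B, a * b ∈ Z} := by
    intro Z hZ
    simp only [Set.ofPred_forall]
    exact isClosed_biInter fun b _ => hZ.preimage (continuous_mul_const b)
  have hcover : A ⊆ {a | ∀ b ∈ B, a * b ∈ Z₁} ∪ {a | ∀ b ∈ B, a * b ∈ Z₂} := by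
    intro a ha
    have := isPreirreducible_iff_isClosed_union_isClosed.1 hB.2 _ _
      (h₁.preimage (continuous_const_mul a)) (h₂.preimage (continuous_const_mul a))
      (fun b hb => h (Set.mul_mem_mul ha hb))
    exact this
  refine (hA' _ _ (hslice _ h₁) (hslice _ h₂) hcover).imp ?_ ?_ <;>
  · rintro h' _ ⟨a, ha, b, hb, rfl⟩
    exact h' ha b hb

theorem IsIrreducible.pow_of_separatelyContinuousMul [SeparatelyContinuousMul G] {A : Set G}
    (hA : IsIrreducible A) (k : ℕ) : IsIrreducible (A ^ k) := by
  induction k with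
  | zero => simpa [← Set.singleton_one] using isIrreducible_singleton
  | succ k ih => rw [pow_succ]; exact ih.mul_of_separatelyContinuousMul hA

/-- A subgroup that contains a nonempty relatively open part of its closure is closed. -/
theorem isClosed_subgroup_of_closure_inter_subset [SeparatelyContinuousMul G] [ContinuousInv G]
    (H : Subgroup G) {U : Set G} (hU : IsOpen U) (hne : ((H : Set G) ∩ U).Nonempty)
    (hsub : closure (H : Set G) ∩ U ⊆ H) : IsClosed (H : Set G) := by
  obtain ⟨h₀, hh₀, hh₀U⟩ := hne
  refine isClosed_of_closure_subset fun g hg => ?_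
  have hopen : IsOpen ((fun x : G => g * x⁻¹ * h₀) ⁻¹' U) :=
    hU.preimage ((continuous_mul_const h₀).comp ((continuous_const_mul g).comp continuous_inv))
  obtain ⟨h, hhU, hh⟩ := mem_closure_iff.1 hg _ hopen (by simpa using hh₀U)
  have hmem : h⁻¹ * h₀ ∈ H := H.mul_mem (H.inv_mem hh) hh₀
  have hcl : g * h⁻¹ * h₀ ∈ closure (H : Set G) := by
    rw [mul_assoc]
    exact map_mem_closure (f := (· * (h⁻¹ * h₀))) (continuous_mul_const _) hg
      fun x hx => H.mul_mem hx hmem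
  have : g * (h⁻¹ * h₀) ∈ H := by
    rw [← mul_assoc]
    exact hsub ⟨hcl, hhU⟩
  exact (H.mul_mem_cancel_right hmem).1 this

end Group

/-- The subgroup generated by a set containing `1` is the union of the powers of `S * S⁻¹`. -/
theorem Subgroup.coe_closure_eq_iUnion_pow {G : Type*} [CommGroup G] {S : Set G} (h1 : 1 ∈ S) :
    (Subgroup.closure S : Set G) = ⋃ k : ℕ, (S * S⁻¹) ^ k := by
  apply Set.Subset.antisymm
  · intro x hx
    rw [Set.mem_iUnion]
    induction hx using Subgroup.closure_induction with
    | mem x hx => exact ⟨1, by simpa using Set.mul_mem_mul hx (Set.inv_mem_inv.2 h1)⟩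
    | one => exact ⟨0, by simp⟩
    | mul x y _ _ hx hy =>
      obtain ⟨k, hk⟩ := hx
      obtain ⟨l, hl⟩ := hy
      exact ⟨k + l, by rw [pow_add]; exact Set.mul_mem_mul hk hl⟩
    | inv x _ hx =>
      obtain ⟨k, hk⟩ := hx
      refine ⟨k, ?_⟩
      have hsymm : (S * S⁻¹)⁻¹ = S * S⁻¹ := by rw [mul_inv, inv_inv, mul_comm]
      rw [← hsymm, inv_pow]
      exact Set.inv_mem_inv.2 hk
  · refine Set.iUnion_subset fun k => ?_
    induction k with
    | zero => simp
    | succ k ih =>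
      rw [pow_succ]
      rintro _ ⟨a, ha, _, ⟨s, hs, t, ht, rfl⟩, rfl⟩
      exact mul_mem (ih ha) (mul_mem (Subgroup.subset_closure hs)
        (by simpa using inv_mem (Subgroup.subset_closure ht)))

/-- A descending sequence of prime ideals in a Noetherian ring stabilizes. -/
theorem Ideal.exists_forall_eq_of_antitone_of_isPrime {R : Type*} [CommRing R] [IsNoetherianRing R]
    {P : ℕ → Ideal R} (hP : ∀ k, (P k).IsPrime) (hanti : Antitone P) :
    ∃ k, ∀ m, k ≤ m → P m = P k := by
  obtain ⟨k, hk⟩ : ∃ k, ∀ m, (P k).height ≤ (P m).height :=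
    ⟨_, fun m => Function.argmin_le (fun k => (P k).height) m⟩
  refine ⟨k, fun m hm => (hanti hm).eq_or_lt.resolve_right fun hlt => ?_⟩
  have := hP m
  have := hP k
  exact (Ideal.height_strict_mono_of_isPrime hlt).not_ge (hk m)

section PolynomialImage

/-- A subset of affine space that is the image of an affine algebraic set under a polynomial
map. -/
def IsPolynomialImage {ι : Type*} (W : Set (ι → ℂ)) : Prop :=
  ∃ (σ : Type) (_ : Finite σ) (J : Set (MvPolynomial σ ℂ)) (φ : ι → MvPolynomial σ ℂ),
    W = {v | ∃ z : σ → ℂ, (∀ p ∈ J, eval z p = 0) ∧ ∀ i, eval z (φ i) = v i}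

variable {ι : Type*}

theorem IsPolynomialImage.mul {V W : Set (ι → ℂ)} (hV : IsPolynomialImage V)
    (hW : IsPolynomialImage W) : IsPolynomialImage (V * W) := by
  obtain ⟨σ, _, J, φ, rfl⟩ := hV
  obtain ⟨τ, _, K, ψ, rfl⟩ := hW
  refine ⟨σ ⊕ τ, inferInstance, rename Sum.inl '' J ∪ rename Sum.inr '' K,
    fun i => rename Sum.inl (φ i) * rename Sum.inr (ψ i), ?_⟩
  ext v
  constructor
  · rintro ⟨a, ⟨z, hz, hza⟩, b, ⟨w, hw, hwb⟩, rfl⟩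
    refine ⟨Sum.elim z w, ?_, fun i => ?_⟩
    · rintro _ (⟨p, hp, rfl⟩ | ⟨p, hp, rfl⟩)
      · simpa [eval_rename] using hz p hp
      · simpa [eval_rename] using hw p hp
    · simp [eval_rename, hza, hwb]
  · rintro ⟨z, hz, hzv⟩
    refine ⟨_, ⟨z ∘ Sum.inl, fun p hp => ?_, fun i => rfl⟩, _,
      ⟨z ∘ Sum.inr, fun p hp => ?_, fun i => rfl⟩, ?_⟩
    · simpa [eval_rename] using hz _ (Or.inl ⟨p, hp, rfl⟩)
    · simpa [eval_rename] using hz _ (Or.inr ⟨p, hp, rfl⟩)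
    · ext i
      simpa [eval_rename] using hzv i

theorem isPolynomialImage_one : IsPolynomialImage (1 : Set (ι → ℂ)) := by
  refine ⟨Empty, inferInstance, ∅, 1, ?_⟩
  ext v
  simp [funext_iff, eq_comm]

theorem IsPolynomialImage.pow {W : Set (ι → ℂ)} (hW : IsPolynomialImage W) (k : ℕ) :
    IsPolynomialImage (W ^ k) := by
  induction k with
  | zero => simpa using isPolynomialImage_one
  | succ k ih => rw [pow_succ]; exact ih.mul hW

/-- The points of a polynomial image correspond to closed points of the image of a closed set of
prime ideals. -/
theorem pointToPoint_mem_comap_image_iff {σ : Type*} [Finite σ] [Finite ι]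
    (J : Set (MvPolynomial σ ℂ)) (φ : ι → MvPolynomial σ ℂ) (v : ι → ℂ) :
    (pointToPoint v : PrimeSpectrum (MvPolynomial ι ℂ)) ∈
        PrimeSpectrum.comap (aeval φ : MvPolynomial ι ℂ →ₐ[ℂ] MvPolynomial σ ℂ).toRingHom ''
          PrimeSpectrum.zeroLocus J ↔
      ∃ z : σ → ℂ, (∀ p ∈ J, eval z p = 0) ∧ ∀ i, eval z (φ i) = v i := by
  constructor
  · rintro ⟨q, hq, hqv⟩
    obtain ⟨M, hM, hqM⟩ := q.asIdeal.exists_le_maximal q.isPrime.ne_top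
    obtain ⟨z, rfl⟩ := isMaximal_iff_eq_vanishingIdeal_singleton.1 hM
    refine ⟨z, fun p hp => ?_, fun i => ?_⟩
    · simpa using hqM (hq hp)
    · have hmem : (X i - C (v i) : MvPolynomial ι ℂ) ∈
          (pointToPoint v : PrimeSpectrum (MvPolynomial ι ℂ)).asIdeal := by
        simp [pointToPoint]
      rw [← hqv] at hmem
      have := hqM hmem
      simpa [sub_eq_zero, algebraMap_eq] using this
  · rintro ⟨z, hz, hzv⟩
    refine ⟨pointToPoint z, fun p hp => ?_, ?_⟩
    · simpa [pointToPoint] using hz p hp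
    · ext p
      have hcomp : aeval z (aeval φ p) = aeval v p := by
        rw [comp_aeval_apply]
        exact congrArg (aeval · p) (funext hzv)
      simpa [pointToPoint] using (congrArg (· = 0) hcomp).to_iff

/-- A polynomial image with prime vanishing ideal contains a nonempty Zariski open subset of its
Zariski closure. -/
theorem IsPolynomialImage.exists_notMem_vanishingIdeal [Finite ι] {W : Set (ι → ℂ)}
    (hW : IsPolynomialImage W) (hprime : (vanishingIdeal ℂ W).IsPrime) :
    ∃ f ∉ vanishingIdeal ℂ W, ∀ v ∈ zeroLocus ℂ (vanishingIdeal ℂ W), eval v f ≠ 0 → v ∈ W := by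
  obtain ⟨σ, _, J, φ, hWeq⟩ := hW
  have hmem : ∀ v, v ∈ W ↔ (pointToPoint v : PrimeSpectrum (MvPolynomial ι ℂ)) ∈
      PrimeSpectrum.comap (aeval φ : MvPolynomial ι ℂ →ₐ[ℂ] MvPolynomial σ ℂ).toRingHom ''
        PrimeSpectrum.zeroLocus J := fun v => by
    rw [pointToPoint_mem_comap_image_iff, hWeq, Set.mem_ofPred_eq]
  have hfp : (aeval φ : MvPolynomial ι ℂ →ₐ[ℂ] MvPolynomial σ ℂ).toRingHom.FinitePresentation := by
    refine RingHom.FinitePresentation.of_finiteType.1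
      (RingHom.FiniteType.of_comp_finiteType (f := algebraMap ℂ (MvPolynomial ι ℂ)) ?_)
    rw [AlgHom.toRingHom_eq_coe, AlgHom.comp_algebraMap]
    exact RingHom.finiteType_algebraMap.2 inferInstance
  have hcons : Topology.IsConstructible (PrimeSpectrum.zeroLocus J) :=
    .of_compl <| IsRetrocompact.isConstructible (PrimeSpectrum.isClosed_zeroLocus J).isOpen_compl
      fun _ _ _ => TopologicalSpace.NoetherianSpace.isCompact _
  obtain ⟨T, hT⟩ := PrimeSpectrum.exists_constructibleSetData_iff.2
    (PrimeSpectrum.isConstructible_comap_image hfp hcons)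
  have hpiece : ∀ v, v ∈ W ↔ ∃ D ∈ T, (∀ j, eval v (D.g j) = 0) ∧ eval v D.f ≠ 0 := fun v => by
    rw [hmem, ← hT]
    simp [PrimeSpectrum.ConstructibleSetData.toSet,
      PrimeSpectrum.BasicConstructibleSetData.toSet, pointToPoint, Set.range_subset_iff]
    exact exists_congr fun D => and_left_comm
  by_contra! hcon
  have hbad : ∀ D ∈ T, ∃ p ∉ vanishingIdeal ℂ W, ∀ v ∈ W,
      (∀ j, eval v (D.g j) = 0) → eval v D.f ≠ 0 → eval v p = 0 := by
    intro D hD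
    by_cases hf : D.f ∈ vanishingIdeal ℂ W
    · exact ⟨1, fun h => hprime.ne_top ((Ideal.eq_top_iff_one _).2 h),
        fun v hv _ hne => absurd (by simpa using hf v hv) hne⟩
    · obtain ⟨v, hv, hvf, hvW⟩ := hcon _ hf
      rw [hpiece] at hvW
      push Not at hvW
      have : ∃ j, eval v (D.g j) ≠ 0 := by
        by_contra! h
        exact hvf (hvW D hD h)
      obtain ⟨j, hj⟩ := this
      exact ⟨D.g j, fun h => hj (by simpa using hv _ h), fun w _ hw _ => hw j⟩
  choose! p hp hpv using hbad
  have hprod : ∏ D ∈ T, p D ∈ vanishingIdeal ℂ W := by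
    intro v hv
    obtain ⟨D, hD, hg, hf⟩ := (hpiece v).1 hv
    simpa [map_prod] using Finset.prod_eq_zero hD (hpv D hD v hv hg hf)
  obtain ⟨D, hD, hmemD⟩ := (hprime.prod_mem_iff).1 hprod
  exact hp D hD hmemD

end PolynomialImage

section Torus

variable {n : ℕ}

theorem isTopologicalBasis_zariskiC (n : ℕ) : @TopologicalSpace.IsTopologicalBasis _ (zariskiC n)
    {U | ∃ p : MvPolynomial (Fin n) ℂ, U = {v | eval v p ≠ 0}} := by
  let := zariskiC n
  refine ⟨?_, ?_, rfl⟩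
  · rintro _ ⟨p, rfl⟩ _ ⟨q, rfl⟩ v hv
    exact ⟨_, ⟨p * q, rfl⟩, by simpa using hv, fun w hw => by simpa using hw⟩
  · exact Set.eq_univ_of_forall fun v => ⟨_, ⟨1, rfl⟩, by simp⟩

theorem isOpen_torusTop_eval_ne_zero (p : MvPolynomial (Fin n) ℂ) :
    IsOpen[torusTop n] {u | eval (torusEmb n u) p ≠ 0} := by
  let := zariskiC n
  have : IsOpen {v : Fin n → ℂ | eval v p ≠ 0} :=
    TopologicalSpace.isOpen_generateFrom_of_mem ⟨p, rfl⟩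
  exact isOpen_induced this

theorem isClosed_torusTop_eval_eq_zero (p : MvPolynomial (Fin n) ℂ) :
    IsClosed[torusTop n] {u | eval (torusEmb n u) p = 0} := by
  let := torusTop n
  rw [← isOpen_compl_iff]
  exact isOpen_torusTop_eval_ne_zero p

theorem mem_closure_torusTop_iff {W : Set (Fin n → ℂˣ)} {u : Fin n → ℂˣ} :
    u ∈ @closure _ (torusTop n) W ↔
      torusEmb n u ∈ zeroLocus ℂ (vanishingIdeal ℂ (torusEmb n '' W)) := by
  let := zariskiC n
  rw [torusTop, closure_induced, (isTopologicalBasis_zariskiC n).mem_closure_iff]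
  constructor
  · intro h p hp
    by_contra hne
    obtain ⟨v, hv, hvW⟩ := h _ ⟨p, rfl⟩ (by simpa using hne)
    exact hv (by simpa using hp v hvW)
  · rintro h _ ⟨p, rfl⟩ hu
    by_contra hemp
    refine hu ?_
    rw [← coe_aeval_eq_eval]
    refine h p fun v hv => ?_
    by_contra hne
    exact hemp ⟨v, by simpa using hne, hv⟩

theorem continuous_torusTop_of_eval {g : (Fin n → ℂˣ) → (Fin n → ℂˣ)}
    (h : ∀ p : MvPolynomial (Fin n) ℂ, ∃ q : MvPolynomial (Fin n) ℂ, ∀ u,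
      eval (torusEmb n (g u)) p = 0 ↔ eval (torusEmb n u) q = 0) :
    @Continuous _ _ (torusTop n) (torusTop n) g := by
  refine continuous_induced_rng.2 (continuous_generateFrom_iff.2 ?_)
  rintro _ ⟨p, rfl⟩
  obtain ⟨q, hq⟩ := h p
  convert isOpen_torusTop_eval_ne_zero q using 1
  exact Set.ext fun u => (hq u).not

theorem continuous_torusTop_mul_left (a : Fin n → ℂˣ) :
    @Continuous _ _ (torusTop n) (torusTop n) (a * ·) := by
  refine continuous_torusTop_of_eval fun p =>
    ⟨aeval (fun i => C (a i : ℂ) * X i) p, fun u => ?_⟩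
  rw [← coe_aeval_eq_eval, ← coe_aeval_eq_eval, RingHom.coe_coe, RingHom.coe_coe,
    comp_aeval_apply]
  simp [torusEmb]
  rfl

theorem separatelyContinuousMul_torusTop : @SeparatelyContinuousMul _ (torusTop n) _ := by
  let := torusTop n
  exact ⟨continuous_torusTop_mul_left _, fun {a} => by
    simpa only [mul_comm] using continuous_torusTop_mul_left a⟩

theorem exists_eval_inv_eq (p : MvPolynomial (Fin n) ℂ) :
    ∃ (q : MvPolynomial (Fin n) ℂ) (d : ℕ), ∀ u : Fin n → ℂˣ,
      eval (torusEmb n u) q = (∏ i, (u i : ℂ)) ^ d * eval (torusEmb n u⁻¹) p := by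
  induction p using MvPolynomial.induction_on with
  | C a => exact ⟨C a, 0, fun u => by simp⟩
  | add p q hp hq =>
    obtain ⟨p', d, hp⟩ := hp
    obtain ⟨q', e, hq⟩ := hq
    refine ⟨(∏ i, X i) ^ e * p' + (∏ i, X i) ^ d * q', d + e, fun u => ?_⟩
    simp only [map_add, map_mul, map_pow, map_prod, eval_X, hp, hq]
    simp only [torusEmb]
    ring
  | mul_X p i hp =>
    obtain ⟨p', d, hp⟩ := hp
    refine ⟨p' * ∏ j ∈ Finset.univ.erase i, X j, d + 1, fun u => ?_⟩
    simp only [map_mul, map_prod, eval_X, hp]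
    rw [pow_succ, ← Finset.mul_prod_erase Finset.univ _ (Finset.mem_univ i)]
    have : (u i : ℂ) ≠ 0 := (u i).ne_zero
    simp only [torusEmb, Pi.inv_apply, Units.val_inv_eq_inv_val]
    field_simp

theorem continuousInv_torusTop : @ContinuousInv _ (torusTop n) _ := by
  let := torusTop n
  refine ⟨continuous_torusTop_of_eval fun p => ?_⟩
  obtain ⟨q, d, hq⟩ := exists_eval_inv_eq p
  refine ⟨q, fun u => ?_⟩
  rw [hq, mul_eq_zero, or_iff_right]
  exact pow_ne_zero _ (Finset.prod_ne_zero_iff.2 fun i _ => (u i).ne_zero)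

theorem isPrime_vanishingIdeal_of_isIrreducible {W : Set (Fin n → ℂˣ)}
    (hW : @IsIrreducible _ (torusTop n) W) : (vanishingIdeal ℂ (torusEmb n '' W)).IsPrime := by
  let := torusTop n
  have hmem : ∀ p, p ∈ vanishingIdeal ℂ (torusEmb n '' W) ↔
      W ⊆ {u | eval (torusEmb n u) p = 0} := fun p => by
    simp [Set.subset_def]
  refine ⟨fun h => ?_, fun {p q} h => ?_⟩
  · obtain ⟨u, hu⟩ := hW.nonempty
    simpa using (hmem 1).1 (h ▸ Submodule.mem_top) hu
  · simp only [hmem] at h ⊢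
    refine isPreirreducible_iff_isClosed_union_isClosed.1 hW.2 _ _
      (isClosed_torusTop_eval_eq_zero p) (isClosed_torusTop_eval_eq_zero q) fun u hu => ?_
    simpa using h hu

theorem torusEmb_image_mul (A B : Set (Fin n → ℂˣ)) :
    torusEmb n '' (A * B) = torusEmb n '' A * torusEmb n '' B :=
  Set.image_mul ((Units.coeHom ℂ).compLeft (Fin n))

theorem torusEmb_image_pow (A : Set (Fin n → ℂˣ)) (k : ℕ) :
    torusEmb n '' (A ^ k) = (torusEmb n '' A) ^ k :=
  Set.image_pow ((Units.coeHom ℂ).compLeft (Fin n)) A k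

theorem torusEmb_injective : Function.Injective (torusEmb n) := fun _ _ h =>
  funext fun i => Units.ext (congrFun h i)

/-- A closed subset of the torus is described inside `ℂⁿ × ℂⁿ` by pairs of inverse vectors. -/
theorem mem_iff_exists_mul_eq_one {S : Set (Fin n → ℂˣ)} (hS : IsClosed[torusTop n] S)
    (v w : Fin n → ℂ) :
    (∃ u ∈ S, torusEmb n u = v ∧ torusEmb n u⁻¹ = w) ↔
      v ∈ zeroLocus ℂ (vanishingIdeal ℂ (torusEmb n '' S)) ∧ ∀ i, v i * w i = 1 := by
  let := torusTop n
  constructor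
  · rintro ⟨u, hu, rfl, rfl⟩
    exact ⟨zeroLocus_vanishingIdeal_le _ ⟨u, hu, rfl⟩, fun i => by simp [torusEmb]⟩
  · rintro ⟨hv, hvw⟩
    have hemb : torusEmb n (fun i => Units.mkOfMulEqOne _ _ (hvw i)) = v := rfl
    refine ⟨fun i => Units.mkOfMulEqOne _ _ (hvw i), ?_, hemb, rfl⟩
    rw [← hS.closure_eq, mem_closure_torusTop_iff]
    exact hv

theorem isPolynomialImage_of_isClosed {S : Set (Fin n → ℂˣ)} (hS : IsClosed[torusTop n] S) :
    IsPolynomialImage (torusEmb n '' S) ∧ IsPolynomialImage (torusEmb n '' S⁻¹) := by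
  let J : Set (MvPolynomial (Fin n ⊕ Fin n) ℂ) :=
    rename Sum.inl '' (vanishingIdeal ℂ (torusEmb n '' S) : Set (MvPolynomial (Fin n) ℂ)) ∪
      Set.range fun i => X (Sum.inl i) * X (Sum.inr i) - 1
  have hJ : ∀ z : Fin n ⊕ Fin n → ℂ, (∀ p ∈ J, eval z p = 0) ↔
      ∃ u ∈ S, torusEmb n u = z ∘ Sum.inl ∧ torusEmb n u⁻¹ = z ∘ Sum.inr := fun z => by
    rw [mem_iff_exists_mul_eq_one hS]
    simp only [J, Set.mem_union, or_imp, forall_and, Set.forall_mem_image, Set.forall_mem_range]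
    simp [eval_rename, sub_eq_zero]
  refine ⟨⟨Fin n ⊕ Fin n, inferInstance, J, fun i => X (Sum.inl i), ?_⟩,
    ⟨Fin n ⊕ Fin n, inferInstance, J, fun i => X (Sum.inr i), ?_⟩⟩ <;> ext v <;>
    simp only [hJ, eval_X] <;> constructor
  · rintro ⟨u, hu, rfl⟩
    exact ⟨Sum.elim (torusEmb n u) (torusEmb n u⁻¹), ⟨u, hu, rfl, rfl⟩, fun i => rfl⟩
  · rintro ⟨z, ⟨u, hu, hz, -⟩, hv⟩
    exact ⟨u, hu, hz.trans (funext hv)⟩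
  · rintro ⟨u, hu, rfl⟩
    exact ⟨Sum.elim (torusEmb n u⁻¹) (torusEmb n u), ⟨u⁻¹, hu, rfl, by simp⟩, fun i => rfl⟩
  · rintro ⟨z, ⟨u, hu, -, hz⟩, hv⟩
    exact ⟨u⁻¹, Set.inv_mem_inv.2 hu, hz.trans (funext hv)⟩

/-- The subgroup of the torus generated by an irreducible closed subset containing the identity is
Zariski closed. -/
theorem isClosed_subgroupClosure_of_isIrreducible {S : Set (Fin n → ℂˣ)} (hone : 1 ∈ S)
    (hirr : @IsIrreducible _ (torusTop n) S) (hclosed : IsClosed[torusTop n] S) :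
    IsClosed[torusTop n] (Subgroup.closure S : Set (Fin n → ℂˣ)) := by
  let := torusTop n
  have : SeparatelyContinuousMul (Fin n → ℂˣ) := separatelyContinuousMul_torusTop
  have : ContinuousInv (Fin n → ℂˣ) := continuousInv_torusTop
  set Y : Set (Fin n → ℂˣ) := S * S⁻¹ with hY
  have hYone : 1 ∈ Y := by simpa using Set.mul_mem_mul hone (Set.inv_mem_inv.2 hone)
  have hYirr : IsIrreducible Y := by
    refine hirr.mul_of_separatelyContinuousMul ?_
    rw [← Set.image_inv_eq_inv]
    exact hirr.image _ continuous_inv.continuousOn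
  have hYmono : Monotone fun k : ℕ => Y ^ k := fun k l h => Set.pow_subset_pow_right hYone h
  have hprime k := isPrime_vanishingIdeal_of_isIrreducible (hYirr.pow_of_separatelyContinuousMul k)
  obtain ⟨k, hk⟩ := Ideal.exists_forall_eq_of_antitone_of_isPrime hprime
    fun k l h => vanishingIdeal_anti_mono (Set.image_mono (hYmono h))
  have hH : (Subgroup.closure S : Set (Fin n → ℂˣ)) = ⋃ k : ℕ, Y ^ k :=
    Subgroup.coe_closure_eq_iUnion_pow hone
  have hYH : Y ^ k ⊆ (Subgroup.closure S : Set (Fin n → ℂˣ)) :=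
    hH ▸ Set.subset_iUnion (fun k : ℕ => Y ^ k) k
  have hideal : vanishingIdeal ℂ (torusEmb n '' (Y ^ k)) ≤
      vanishingIdeal ℂ (torusEmb n '' (Subgroup.closure S : Set (Fin n → ℂˣ))) := by
    rintro p hp _ ⟨u, hu, rfl⟩
    rw [hH, Set.mem_iUnion] at hu
    obtain ⟨m, hm⟩ := hu
    rw [← hk _ (le_max_left k m)] at hp
    exact hp _ ⟨u, hYmono (le_max_right k m) hm, rfl⟩
  have himage : IsPolynomialImage (torusEmb n '' (Y ^ k)) := by
    obtain ⟨h₁, h₂⟩ := isPolynomialImage_of_isClosed hclosed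
    rw [torusEmb_image_pow, hY, torusEmb_image_mul]
    exact (h₁.mul h₂).pow k
  obtain ⟨f, hf, hfv⟩ := himage.exists_notMem_vanishingIdeal (hprime k)
  refine isClosed_subgroup_of_closure_inter_subset _ (isOpen_torusTop_eval_ne_zero f) ?_ ?_
  · by_contra hemp
    refine hf ?_
    rintro _ ⟨u, hu, rfl⟩
    by_contra hne
    exact hemp ⟨u, hYH hu, by simpa using hne⟩
  · rintro u ⟨hu, hfu⟩
    rw [mem_closure_torusTop_iff] at hu
    exact hYH (torusEmb_injective.mem_set_image.1
      (hfv _ (zeroLocus_anti_mono hideal hu) hfu))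

end Torus

theorem expTorus_add {n : ℕ} (z w : Fin n → ℂ) :
    expTorus n (z + w) = expTorus n z * expTorus n w :=
  funext fun i => Units.ext (Complex.exp_add (z i) (w i))

theorem expTorus_neg {n : ℕ} (z : Fin n → ℂ) : expTorus n (-z) = (expTorus n z)⁻¹ :=
  funext fun i => Units.ext <| by simp [expTorus, Complex.exp_neg]

theorem expTorus_zero {n : ℕ} : expTorus n 0 = 1 :=
  funext fun _ => Units.ext Complex.exp_zero

theorem subgroupClosure_subset_expTorus_image {n : ℕ} {S : Set (Fin n → ℂˣ)}
    {𝔥 : Submodule ℂ (Fin n → ℂ)} (hsub : S ⊆ expTorus n '' (𝔥 : Set (Fin n → ℂ))) :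
    (Subgroup.closure S : Set (Fin n → ℂˣ)) ⊆ expTorus n '' (𝔥 : Set (Fin n → ℂ)) := by
  intro u hu
  induction hu using Subgroup.closure_induction with
  | mem u hu => exact hsub hu
  | one => exact ⟨0, 𝔥.zero_mem, expTorus_zero⟩
  | mul u v _ _ hu hv =>
    obtain ⟨z, hz, rfl⟩ := hu
    obtain ⟨w, hw, rfl⟩ := hv
    exact ⟨z + w, 𝔥.add_mem hz hw, expTorus_add z w⟩
  | inv u _ hu =>
    obtain ⟨z, hz, rfl⟩ := hu
    exact ⟨-z, 𝔥.neg_mem hz, expTorus_neg z⟩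

theorem generated_subgroup_closed_and_in_exp
    {n : ℕ} (S : Set (Fin n → ℂˣ)) (𝔥 : Submodule ℂ (Fin n → ℂ))
    (hone : (1 : Fin n → ℂˣ) ∈ S)
    (hirr : @IsIrreducible _ (torusTop n) S)
    (hclosed : @IsClosed _ (torusTop n) S)
    (hsub : S ⊆ expTorus n '' (𝔥 : Set (Fin n → ℂ))) :
    @IsClosed _ (torusTop n) ((Subgroup.closure S : Subgroup (Fin n → ℂˣ)) : Set (Fin n → ℂˣ)) ∧
    ((Subgroup.closure S : Subgroup (Fin n → ℂˣ)) : Set (Fin n → ℂˣ)) ⊆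
      expTorus n '' (𝔥 : Set (Fin n → ℂ)) ∧
    ∀ H : Subgroup (Fin n → ℂˣ), @IsClosed _ (torusTop n) (H : Set (Fin n → ℂˣ)) →
      S ⊆ (H : Set (Fin n → ℂˣ)) → Subgroup.closure S ≤ H :=
  ⟨isClosed_subgroupClosure_of_isIrreducible hone hirr hclosed,
    subgroupClosure_subset_expTorus_image hsub, fun H _ hSH => (Subgroup.closure_le H).2 hSH⟩
end

section
/- Let S ⊆ (ℂˣ)ⁿ be a subset containing the identity (1,…,1) which is irreducible and closed in the Zariski topology of (ℂˣ)ⁿ, and suppose S ⊆ exp(𝔥) for some ℂ-linear subspace 𝔥 ⊆ ℂⁿ, where exp: ℂⁿ → (ℂˣ)ⁿ is the coordinatewise complex exponential. Then the topological Krull dimension of the subgroup of (ℂˣ)ⁿ generated by S, equipped with its subspace Zariski topology, is at most dim_ℂ 𝔥. -/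
/-!
STATEMENT 2. Let `S ⊆ (ℂˣ)ⁿ` contain the identity, be irreducible and closed in the
Zariski topology of `(ℂˣ)ⁿ`, and suppose `S ⊆ exp(𝔥)` for a `ℂ`-linear subspace
`𝔥 ⊆ ℂⁿ` (`exp` the coordinatewise complex exponential). Then the topological Krull
dimension of the subgroup of `(ℂˣ)ⁿ` generated by `S`, with its subspace Zariski
topology, is at most `dim_ℂ 𝔥`.
-/

open MvPolynomial

open scoped Topology

/-- Every Zariski open set of the torus is a union of basic open sets. -/
lemma exists_eval_ne_zero_of_isOpen {n : ℕ} {U : Set (Fin n → ℂ)} (hU : IsOpen[zariskiC n] U)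
    {x : Fin n → ℂ} (hx : x ∈ U) :
    ∃ p : MvPolynomial (Fin n) ℂ, eval x p ≠ 0 ∧ ∀ y, eval y p ≠ 0 → y ∈ U := by
  induction hU with
  | basic s hs =>
    obtain ⟨p, rfl⟩ := hs
    exact ⟨p, hx, fun _ h => h⟩
  | univ => exact ⟨1, by simp, fun _ _ => trivial⟩
  | inter s t _ _ hs ht =>
    obtain ⟨p, hp, hp'⟩ := hs hx.1
    obtain ⟨q, hq, hq'⟩ := ht hx.2
    refine ⟨p * q, by simp [hp, hq], fun y hy => ?_⟩
    rw [map_mul] at hy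
    exact ⟨hp' y (left_ne_zero_of_mul hy), hq' y (right_ne_zero_of_mul hy)⟩
  | sUnion s _ ih =>
    obtain ⟨t, ht, hxt⟩ := hx
    obtain ⟨p, hp, hp'⟩ := ih t ht hxt
    exact ⟨p, hp, fun y hy => ⟨t, ht, hp' y hy⟩⟩

lemma isClosed_eval_torusEmb_eq_zero {n : ℕ} (p : MvPolynomial (Fin n) ℂ) :
    IsClosed[torusTop n] {u | eval (torusEmb n u) p = 0} := by
  let _ := torusTop n
  rw [← isOpen_compl_iff]
  exact ⟨{v | eval v p ≠ 0}, TopologicalSpace.isOpen_generateFrom_of_mem ⟨p, rfl⟩, rfl⟩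

lemma exists_eval_eq_zero_of_isClosed {n : ℕ} {Z : Set (Fin n → ℂˣ)}
    (hZ : IsClosed[torusTop n] Z) {x : Fin n → ℂˣ} (hx : x ∉ Z) :
    ∃ p : MvPolynomial (Fin n) ℂ, eval (torusEmb n x) p ≠ 0 ∧
      ∀ z ∈ Z, eval (torusEmb n z) p = 0 := by
  let _ := torusTop n
  obtain ⟨U, hU, hUZ⟩ := hZ.isOpen_compl
  have hmem : ∀ y, torusEmb n y ∈ U ↔ y ∉ Z := fun y => Set.ext_iff.mp hUZ y
  obtain ⟨p, hp, hp'⟩ := exists_eval_ne_zero_of_isOpen hU ((hmem x).mpr hx)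
  refine ⟨p, hp, fun z hz => ?_⟩
  by_contra h
  exact (hmem z).mp (hp' _ h) hz

/-- If the zero sets of the functions in an algebra `A` form a basis of closed sets of `X`,
then the dimension of `X` is at most that of `A`. -/
lemma topologicalKrullDim_le_ringKrullDim {X : Type*} [TopologicalSpace X]
    (A : Subalgebra ℂ (X → ℂ)) (hcl : ∀ f ∈ A, IsClosed {x | f x = 0})
    (hsep : ∀ Z : Set X, IsClosed Z → ∀ x ∉ Z, ∃ f ∈ A, f x ≠ 0 ∧ ∀ z ∈ Z, f z = 0) :
    topologicalKrullDim X ≤ ringKrullDim A := by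
  let I (Z : Set X) : Ideal A :=
    { carrier := {f | ∀ z ∈ Z, f.1 z = 0}
      add_mem' := fun {f g} hf hg z hz => by
        change f.1 z + g.1 z = 0
        rw [hf z hz, hg z hz, add_zero]
      zero_mem' := fun _ _ => rfl
      smul_mem' := fun c f hf z hz => by
        change c.1 z * f.1 z = 0
        rw [hf z hz, mul_zero] }
  have hprime (Z : TopologicalSpace.IrreducibleCloseds X) : (I Z).IsPrime := by
    refine ⟨fun h => ?_, fun {f g} hfg => ?_⟩
    · obtain ⟨z, hz⟩ := Z.isIrreducible'.nonempty
      have h1 : (1 : A) ∈ I Z := h ▸ Submodule.mem_top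
      exact one_ne_zero (α := ℂ) (h1 z hz)
    · exact isPreirreducible_iff_isClosed_union_isClosed.mp Z.isIrreducible'.isPreirreducible
        _ _ (hcl f f.2) (hcl g g.2) fun z hz => mul_eq_zero.mp (hfg z hz)
  let F (Z : TopologicalSpace.IrreducibleCloseds X) : (PrimeSpectrum A)ᵒᵈ :=
    OrderDual.toDual ⟨I Z, hprime Z⟩
  have hF : StrictMono F := by
    refine Monotone.strictMono_of_injective (fun Z W hZW f hf z hz => hf z (hZW hz)) ?_
    intro Z W h
    have hI : I Z = I W := congrArg PrimeSpectrum.asIdeal (OrderDual.toDual.injective h)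
    have key : ∀ Z W : TopologicalSpace.IrreducibleCloseds X, I Z = I W → (Z : Set X) ⊆ W := by
      intro Z W hI z hz
      by_contra hzW
      obtain ⟨f, hfA, hfz, hfW⟩ := hsep W W.isClosed' z hzW
      have : (⟨f, hfA⟩ : A) ∈ I Z := hI ▸ hfW
      exact hfz (this z hz)
    exact SetLike.coe_injective ((key Z W hI).antisymm (key W Z hI.symm))
  exact (Order.krullDim_le_of_strictMono F hF).trans_eq Order.krullDim_orderDual

lemma ringKrullDim_le_of_isIntegral {R A : Type*} [CommRing R] [CommRing A]
    (f : R →+* A) (hf : f.IsIntegral) : ringKrullDim A ≤ ringKrullDim R := by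
  algebraize [f]
  exact Order.krullDim_le_of_strictMono (PrimeSpectrum.comap f) fun I J hIJ =>
    Ideal.IsIntegral.comap_lt_comap (R := R) (A := A) (I := I.asIdeal) (J := J.asIdeal) hIJ

/-- A product of irreducible spaces has no zero divisors among the functions whose zero sets
are separately closed. -/
lemma eq_zero_or_eq_zero_of_mul_eq_zero {X : Type*} [TopologicalSpace X] [PreirreducibleSpace X]
    {N : ℕ} (f g : (Fin N → X) → ℂ)
    (hf : ∀ v j, IsClosed {x | f (Function.update v j x) = 0})
    (hg : ∀ v j, IsClosed {x | g (Function.update v j x) = 0})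
    (hfg : f * g = 0) : f = 0 ∨ g = 0 := by
  induction N with
  | zero =>
    rcases mul_eq_zero.mp (congrFun hfg default) with h | h
    · exact Or.inl (funext fun v => by rw [Subsingleton.elim v default, h]; rfl)
    · exact Or.inr (funext fun v => by rw [Subsingleton.elim v default, h]; rfl)
  | succ N ih =>
    have closed_section (f : (Fin (N + 1) → X) → ℂ)
        (hf : ∀ v j, IsClosed {x | f (Function.update v j x) = 0}) :
        IsClosed {x | ∀ w, f (Fin.cons x w) = 0} := by
      rw [Set.ofPred_forall]
      refine isClosed_iInter fun w => isClosed_iff_frequently.mpr ?_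
      intro x hx
      have h := hf (Fin.cons x w) 0
      simp only [Fin.update_cons_zero] at h
      exact isClosed_iff_frequently.mp h x hx
    have hsec (x : X) : (∀ w, f (Fin.cons x w) = 0) ∨ (∀ w, g (Fin.cons x w) = 0) := by
      have := ih (fun w => f (Fin.cons x w)) (fun w => g (Fin.cons x w))
        (fun v j => by simpa only [Fin.cons_update] using hf (Fin.cons x v) j.succ)
        (fun v j => by simpa only [Fin.cons_update] using hg (Fin.cons x v) j.succ)
        (funext fun w => congrFun hfg _)
      exact this.imp (fun h w => congrFun h w) (fun h w => congrFun h w)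
    have key := isPreirreducible_iff_isClosed_union_isClosed.mp
      (PreirreducibleSpace.isPreirreducible_univ (X := X)) _ _ (closed_section f hf)
      (closed_section g hg) (fun x _ => hsec x)
    refine key.imp (fun h => funext fun v => ?_) (fun h => funext fun v => ?_) <;>
    · rw [← Fin.cons_self_tail v]
      exact h (Set.mem_univ (v 0)) (Fin.tail v)

/-- A generic point of affine space lifts along a dominant morphism of finite type. -/
lemma exists_generic_lift {s : ℕ} {B : Type*} [CommRing B] [IsDomain B] [Algebra ℂ B]
    [Algebra.FiniteType ℂ B] (φ : MvPolynomial (Fin s) ℂ →ₐ[ℂ] B)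
    (hφ : Function.Injective φ) :
    ∃ f : MvPolynomial (Fin s) ℂ, f ≠ 0 ∧ ∀ w : Fin s → ℂ, eval w f ≠ 0 →
      ∃ b : B →ₐ[ℂ] ℂ, ∀ k, b (φ (X k)) = w k := by
  have hfin : φ.toRingHom.FinitePresentation := by
    refine RingHom.FinitePresentation.of_finiteType.mp ?_
    refine RingHom.FiniteType.of_comp_finiteType (f := algebraMap ℂ _) ?_
    rw [AlgHom.toRingHom_eq_coe, φ.comp_algebraMap]
    exact RingHom.finiteType_algebraMap.mpr inferInstance
  obtain ⟨T, hT⟩ := PrimeSpectrum.exists_constructibleSetData_iff.mpr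
    (PrimeSpectrum.isConstructible_range_comap hfin)
  have hbot : (⊥ : PrimeSpectrum (MvPolynomial (Fin s) ℂ)) ∈ T.toSet := by
    rw [hT]
    refine ⟨⊥, PrimeSpectrum.ext ?_⟩
    exact (RingHom.injective_iff_ker_eq_bot _).mp hφ
  simp only [PrimeSpectrum.ConstructibleSetData.toSet, Set.mem_iUnion] at hbot
  obtain ⟨D, hDT, hDg, hDf⟩ := hbot
  have hg0 : ∀ i, D.g i = 0 := fun i => hDg ⟨i, rfl⟩
  have hf0 : D.f ≠ 0 := fun h => hDf (by
    rintro _ rfl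
    exact h)
  refine ⟨D.f, hf0, fun w hw => ?_⟩
  let m : PrimeSpectrum (MvPolynomial (Fin s) ℂ) :=
    ⟨RingHom.ker (eval w), RingHom.ker_isPrime _⟩
  have hm : m ∈ T.toSet := by
    simp only [PrimeSpectrum.ConstructibleSetData.toSet, Set.mem_iUnion]
    refine ⟨D, hDT, ?_, fun h => hw (h rfl)⟩
    rintro _ ⟨i, rfl⟩
    rw [hg0 i]
    exact Ideal.zero_mem _
  rw [hT] at hm
  obtain ⟨q, hq⟩ := hm
  obtain ⟨M, hM, hqM⟩ := Ideal.exists_le_maximal q.asIdeal q.2.ne_top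
  let _ := Ideal.Quotient.field M
  have : Module.Finite ℂ (B ⧸ M) := finite_of_finite_type_of_isJacobsonRing ℂ (B ⧸ M)
  let e := AlgEquiv.ofBijective (Algebra.ofId ℂ (B ⧸ M))
    (IsAlgClosed.algebraMap_bijective_of_isIntegral (k := ℂ) (K := B ⧸ M))
  refine ⟨e.symm.toAlgHom.comp (Ideal.Quotient.mkₐ ℂ M), fun k => ?_⟩
  have hmem : X k - C (w k) ∈ RingHom.ker (eval w) := by simp [RingHom.mem_ker]
  have hmem' : φ (X k - C (w k)) ∈ M := by
    apply hqM
    have h : X k - C (w k) ∈ (PrimeSpectrum.comap φ.toRingHom q).asIdeal := by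
      rw [hq]
      exact hmem
    exact h
  have hz : Ideal.Quotient.mkₐ ℂ M (φ (X k - C (w k))) = 0 :=
    Ideal.Quotient.eq_zero_iff_mem.mpr hmem'
  have hC : φ (C (w k)) = algebraMap ℂ B (w k) := φ.commutes (w k)
  rw [map_sub, map_sub, sub_eq_zero, hC, AlgHom.commutes] at hz
  change e.symm (Ideal.Quotient.mkₐ ℂ M (φ (X k))) = w k
  rw [hz, AlgEquiv.commutes]
  rfl

/-- The coordinate algebra of the power `Sᴺ` of a subset `S` of the torus. -/
noncomputable def torusPowAlg {n : ℕ} (S : Set (Fin n → ℂˣ)) (N : ℕ) :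
    Subalgebra ℂ ((Fin N → S) → ℂ) :=
  Algebra.adjoin ℂ
    (Set.range (fun (q : Fin N × Fin n) (v : Fin N → S) => (((v q.1).1 q.2 : ℂˣ) : ℂ)) ∪
      Set.range (fun (q : Fin N × Fin n) (v : Fin N → S) => ((((v q.1).1 q.2)⁻¹ : ℂˣ) : ℂ)))

namespace torusPowAlg

variable {n : ℕ} {S : Set (Fin n → ℂˣ)} {N : ℕ}

lemma coord_mem (j : Fin N) (i : Fin n) :
    (fun v : Fin N → S => (((v j).1 i : ℂˣ) : ℂ)) ∈ torusPowAlg S N :=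
  Algebra.subset_adjoin (Or.inl ⟨(j, i), rfl⟩)

lemma coord_inv_mem (j : Fin N) (i : Fin n) :
    (fun v : Fin N → S => ((((v j).1 i)⁻¹ : ℂˣ) : ℂ)) ∈ torusPowAlg S N :=
  Algebra.subset_adjoin (Or.inr ⟨(j, i), rfl⟩)

instance finiteType : Algebra.FiniteType ℂ (torusPowAlg S N) :=
  (torusPowAlg S N).fg_iff_finiteType.mp
    (Subalgebra.fg_def.mpr ⟨_, (Set.finite_range _).union (Set.finite_range _), rfl⟩)

/-- In each variable separately, a function of the coordinate algebra becomes polynomial after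
clearing denominators. -/
lemma exists_section_mul_eq_eval {F : (Fin N → S) → ℂ} (hF : F ∈ torusPowAlg S N)
    (v : Fin N → S) (j : Fin N) :
    ∃ (p : MvPolynomial (Fin n) ℂ) (k : ℕ), ∀ x : S,
      F (Function.update v j x) * (∏ i, ((x.1 i : ℂˣ) : ℂ)) ^ k = eval (torusEmb n x) p := by
  induction hF using Algebra.adjoin_induction with
  | mem F hF =>
    rcases hF with ⟨⟨j', i⟩, rfl⟩ | ⟨⟨j', i⟩, rfl⟩ <;> by_cases h : j' = j
    · exact ⟨X i, 0, fun x => by simp [h, torusEmb]⟩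
    · exact ⟨C ((v j').1 i : ℂ), 0, fun x => by simp [h]⟩
    · refine ⟨∏ i' ∈ Finset.univ.erase i, X i', 1, fun x => ?_⟩
      rw [← Finset.mul_prod_erase _ _ (Finset.mem_univ i)]
      simp [h, torusEmb]
    · exact ⟨C (((v j').1 i)⁻¹ : ℂˣ).val, 0, fun x => by simp [h]⟩
  | algebraMap c => exact ⟨C c, 0, fun x => by simp⟩
  | add F G _ _ hF hG =>
    obtain ⟨p, k, hp⟩ := hF
    obtain ⟨q, l, hq⟩ := hG
    refine ⟨p * (∏ i, X i) ^ l + q * (∏ i, X i) ^ k, k + l, fun x => ?_⟩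
    rw [map_add, map_mul, map_mul, ← hp x, ← hq x]
    simp only [map_pow, map_prod, eval_X, torusEmb, Pi.add_apply]
    ring
  | mul F G _ _ hF hG =>
    obtain ⟨p, k, hp⟩ := hF
    obtain ⟨q, l, hq⟩ := hG
    refine ⟨p * q, k + l, fun x => ?_⟩
    rw [map_mul, ← hp x, ← hq x, Pi.mul_apply]
    ring

lemma isClosed_section [TopologicalSpace S]
    (hS : ∀ p : MvPolynomial (Fin n) ℂ, IsClosed {x : S | eval (torusEmb n x) p = 0})
    {F : (Fin N → S) → ℂ} (hF : F ∈ torusPowAlg S N) (v : Fin N → S) (j : Fin N) :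
    IsClosed {x | F (Function.update v j x) = 0} := by
  obtain ⟨p, k, hp⟩ := exists_section_mul_eq_eval hF v j
  convert hS p using 3 with x
  rw [← hp x, mul_eq_zero, or_iff_left]
  exact pow_ne_zero _ (Finset.prod_ne_zero_iff.mpr fun i _ => (x.1 i).ne_zero)

lemma isDomain [TopologicalSpace S] [IrreducibleSpace S]
    (hS : ∀ p : MvPolynomial (Fin n) ℂ, IsClosed {x : S | eval (torusEmb n x) p = 0}) :
    IsDomain (torusPowAlg S N) := by
  have : Nonempty (Fin N → S) := inferInstance
  have : NoZeroDivisors (torusPowAlg S N) := ⟨fun {F G} h => by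
    have := eq_zero_or_eq_zero_of_mul_eq_zero F.1 G.1 (isClosed_section hS F.2)
      (isClosed_section hS G.2) (congrArg Subtype.val h)
    exact this.imp Subtype.ext Subtype.ext⟩
  exact NoZeroDivisors.to_isDomain _

/-- For closed `S`, the complex points of the coordinate algebra of `Sᴺ` are the points of `Sᴺ`. -/
lemma exists_eq_apply (hclosed : IsClosed[torusTop n] S) (b : torusPowAlg S N →ₐ[ℂ] ℂ) :
    ∃ v : Fin N → S, ∀ F, b F = F.1 v := by
  let c (j : Fin N) (i : Fin n) : torusPowAlg S N := ⟨_, coord_mem j i⟩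
  let d (j : Fin N) (i : Fin n) : torusPowAlg S N := ⟨_, coord_inv_mem j i⟩
  have hcd (j i) : c j i * d j i = 1 := Subtype.ext (funext fun v => Units.mul_inv _)
  have hbcd (j i) : b (c j i) * b (d j i) = 1 := by rw [← map_mul, hcd, map_one]
  let w (j : Fin N) (i : Fin n) : ℂˣ :=
    ⟨b (c j i), b (d j i), hbcd j i, by rw [mul_comm, hbcd]⟩
  have hw (j) : w j ∈ S := by
    by_contra hj
    obtain ⟨p, hp, hpS⟩ := exists_eval_eq_zero_of_isClosed hclosed hj
    have h0 : aeval (c j) p = 0 := by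
      refine Subtype.ext (funext fun v => ?_)
      have := MvPolynomial.comp_aeval_apply (c j)
        ((Pi.evalAlgHom ℂ (fun _ => ℂ) v).comp (torusPowAlg S N).val) p
      exact this.trans (hpS _ (v j).2)
    apply hp
    have := MvPolynomial.comp_aeval_apply (c j) b p
    rw [h0, map_zero] at this
    exact this.symm
  refine ⟨fun j => ⟨w j, hw j⟩, ?_⟩
  suffices h : b = (Pi.evalAlgHom ℂ (fun _ => ℂ) (fun j => (⟨w j, hw j⟩ : S))).comp
      (torusPowAlg S N).val from fun F => congrArg (fun f => f F) h
  refine AlgHom.adjoin_ext ?_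
  rintro _ (⟨⟨j, i⟩, rfl⟩ | ⟨⟨j, i⟩, rfl⟩) <;> rfl

end torusPowAlg

/-- The value at `v ∈ Sᴺ` of the word with exponents `ε`. -/
def torusWord {n : ℕ} {S : Set (Fin n → ℂˣ)} {N : ℕ} (ε : Fin N → ℤ) (v : Fin N → S) :
    Subgroup.closure S :=
  ∏ j, (⟨(v j).1, Subgroup.subset_closure (v j).2⟩ : Subgroup.closure S) ^ ε j

section torusWord

variable {n : ℕ} {S : Set (Fin n → ℂˣ)}

lemma torusWord_coe_apply {N : ℕ} (ε : Fin N → ℤ) (v : Fin N → S) (i : Fin n) :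
    (((torusWord ε v).1 i : ℂˣ) : ℂ) = ∏ j, (((v j).1 i ^ ε j : ℂˣ) : ℂ) := by
  simp [torusWord]

lemma torusWord_append {N N' : ℕ} (ε : Fin N → ℤ) (ε' : Fin N' → ℤ) (v : Fin N → S)
    (v' : Fin N' → S) :
    torusWord (Fin.append ε ε') (Fin.append v v') = torusWord ε v * torusWord ε' v' := by
  simp [torusWord, Fin.prod_univ_add]

lemma torusWord_const_one (hone : (1 : Fin n → ℂˣ) ∈ S) {N : ℕ} (ε : Fin N → ℤ) :
    torusWord ε (fun _ => (⟨1, hone⟩ : S)) = 1 := by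
  refine Finset.prod_eq_one fun j _ => ?_
  exact one_zpow (α := Subgroup.closure S) (ε j)

lemma exists_torusWord_eq (h : Subgroup.closure S) :
    ∃ (N : ℕ) (ε : Fin N → ℤ) (v : Fin N → S), torusWord ε v = h := by
  obtain ⟨h, hh⟩ := h
  induction hh using Subgroup.closure_induction with
  | mem x hx => exact ⟨1, fun _ => 1, fun _ => ⟨x, hx⟩, by simp [torusWord]⟩
  | one => exact ⟨0, Fin.elim0, Fin.elim0, Fin.prod_univ_zero _⟩
  | mul x y _ _ hx hy =>
    obtain ⟨N, ε, v, hv⟩ := hx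
    obtain ⟨N', ε', v', hv'⟩ := hy
    exact ⟨N + N', Fin.append ε ε', Fin.append v v', by rw [torusWord_append, hv, hv']; rfl⟩
  | inv x _ hx =>
    obtain ⟨N, ε, v, hv⟩ := hx
    refine ⟨N, fun j => -ε j, v, ?_⟩
    have : torusWord (fun j => -ε j) v = (torusWord ε v)⁻¹ := by simp [torusWord]
    rw [this, hv]
    rfl

end torusWord

/-- The algebra of polynomial functions on a set of points of the torus. -/
noncomputable def torusPolyAlg {n : ℕ} (H : Set (Fin n → ℂˣ)) : Subalgebra ℂ (H → ℂ) :=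
  (aeval fun (i : Fin n) (h : H) => ((h.1 i : ℂˣ) : ℂ)).range

lemma aeval_torus_apply {n : ℕ} {H : Set (Fin n → ℂˣ)} (p : MvPolynomial (Fin n) ℂ) (h : H) :
    aeval (fun (i : Fin n) (h : H) => ((h.1 i : ℂˣ) : ℂ)) p h = eval (torusEmb n h) p :=
  MvPolynomial.comp_aeval_apply _ (Pi.evalAlgHom ℂ (fun _ => ℂ) h) p

lemma torusPolyAlg_comp_torusWord_mem {n : ℕ} {S : Set (Fin n → ℂˣ)} {N : ℕ} (ε : Fin N → ℤ)
    {f : ((Subgroup.closure S : Subgroup (Fin n → ℂˣ)) : Set (Fin n → ℂˣ)) → ℂ}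
    (hf : f ∈ torusPolyAlg _) :
    (fun v => f (torusWord ε v)) ∈ torusPowAlg S N := by
  obtain ⟨p, rfl⟩ := hf
  have hmem (i : Fin n) : (fun v : Fin N → S => (((torusWord ε v).1 i : ℂˣ) : ℂ)) ∈
      torusPowAlg S N := by
    have heq : (fun v : Fin N → S => (((torusWord ε v).1 i : ℂˣ) : ℂ)) =
        ∏ j, fun v : Fin N → S => (((v j).1 i ^ ε j : ℂˣ) : ℂ) := by
      funext v
      rw [torusWord_coe_apply, Finset.prod_apply]
    rw [heq]
    refine prod_mem fun j _ => ?_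
    obtain ⟨k, hk | hk⟩ := (ε j).eq_nat_or_neg
    · simpa [hk] using! pow_mem (torusPowAlg.coord_mem (S := S) j i) k
    · convert pow_mem (torusPowAlg.coord_inv_mem (S := S) j i) k using 1
      funext v
      simp [hk]
  let c (i : Fin n) : torusPowAlg S N := ⟨_, hmem i⟩
  convert (aeval c p).2 using 1
  funext v
  have h1 := MvPolynomial.comp_aeval_apply c
    ((Pi.evalAlgHom ℂ (fun _ => ℂ) v).comp (torusPowAlg S N).val) p
  exact (aeval_torus_apply p _).trans h1.symm

instance torusPolyAlg.finiteType {n : ℕ} (H : Set (Fin n → ℂˣ)) :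
    Algebra.FiniteType ℂ (torusPolyAlg H) :=
  Algebra.FiniteType.of_surjective (AlgHom.rangeRestrict _) (AlgHom.rangeRestrict_surjective _)

lemma topologicalKrullDim_torus_le {n : ℕ} (H : Set (Fin n → ℂˣ)) :
    @topologicalKrullDim H (TopologicalSpace.induced Subtype.val (torusTop n)) ≤
      ringKrullDim (torusPolyAlg H) := by
  let _ : TopologicalSpace H := TopologicalSpace.induced Subtype.val (torusTop n)
  refine topologicalKrullDim_le_ringKrullDim _ ?_ ?_
  · rintro _ ⟨p, rfl⟩
    have h : IsClosed {x : H | eval (torusEmb n x) p = 0} := by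
      let _ := torusTop n
      exact (isClosed_eval_torusEmb_eq_zero p).preimage continuous_induced_dom
    convert h using 3 with x
    exact Eq.congr_left (aeval_torus_apply p x)
  · intro Z hZ x hx
    obtain ⟨W, hW, rfl⟩ := (@isClosed_induced_iff _ _ (torusTop n) _ _).mp hZ
    obtain ⟨p, hp, hpW⟩ := exists_eval_eq_zero_of_isClosed hW hx
    exact ⟨_, ⟨p, rfl⟩, (aeval_torus_apply p x).trans_ne hp,
      fun z hz => (aeval_torus_apply p z).trans (hpW _ hz)⟩

/-- The map of algebras given by composition with the word map of exponents `ε`. -/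
noncomputable def torusPullback {n : ℕ} {S : Set (Fin n → ℂˣ)} {N : ℕ} (ε : Fin N → ℤ) :
    torusPolyAlg ((Subgroup.closure S : Subgroup (Fin n → ℂˣ)) : Set (Fin n → ℂˣ)) →ₐ[ℂ]
      torusPowAlg S N where
  toFun f := ⟨_, torusPolyAlg_comp_torusWord_mem ε f.2⟩
  map_one' := rfl
  map_mul' _ _ := rfl
  map_zero' := rfl
  map_add' _ _ := rfl
  commutes' _ := rfl

lemma exists_injective_pullback {n s : ℕ} {S : Set (Fin n → ℂˣ)}
    (hone : (1 : Fin n → ℂˣ) ∈ S) (hdom : ∀ N, IsDomain (torusPowAlg S N))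
    (g : MvPolynomial (Fin s) ℂ →ₐ[ℂ]
      torusPolyAlg ((Subgroup.closure S : Subgroup (Fin n → ℂˣ)) : Set (Fin n → ℂˣ)))
    (hg : Function.Injective g) :
    ∃ (N : ℕ) (ε : Fin N → ℤ), Function.Injective ((torusPullback ε).comp g) := by
  have : FiniteRingKrullDim (MvPolynomial (Fin s) ℂ) := by
    rw [finiteRingKrullDim_iff_ne_bot_and_top, MvPolynomial.ringKrullDim_of_isNoetherianRing,
      ringKrullDim_eq_zero_of_field, zero_add]
    exact ⟨WithBot.coe_ne_bot, fun h => ENat.natCast_ne_top _ (WithBot.coe_injective h)⟩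
  have hwf : WellFounded fun P Q : PrimeSpectrum (MvPolynomial (Fin s) ℂ) => P < Q :=
    SetRel.IsWellFounded.of_finiteDimensional (r := {q : PrimeSpectrum (MvPolynomial (Fin s) ℂ) × _ | q.1 < q.2})
  let K (q : Σ N, Fin N → ℤ) : PrimeSpectrum (MvPolynomial (Fin s) ℂ) :=
    ⟨RingHom.ker ((torusPullback q.2).comp g), RingHom.ker_isPrime _⟩
  have hK (q : Σ N, Fin N → ℤ) (p : MvPolynomial (Fin s) ℂ) :
      p ∈ (K q).asIdeal ↔ ∀ v, (g p).1 (torusWord q.2 v) = 0 :=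
    ⟨fun h v => congrFun (congrArg Subtype.val h) v, fun h => Subtype.ext (funext h)⟩
  obtain ⟨_, ⟨q, rfl⟩, hmin⟩ := hwf.has_min (Set.range K) ⟨_, ⟨0, Fin.elim0⟩, rfl⟩
  refine ⟨q.1, q.2, (injective_iff_map_eq_zero _).mpr fun p hp => ?_⟩
  apply hg
  rw [map_zero]
  refine Subtype.ext (funext fun h => ?_)
  obtain ⟨N', ε', v', rfl⟩ := exists_torusWord_eq h
  let r : Σ N, Fin N → ℤ := ⟨q.1 + N', Fin.append q.2 ε'⟩
  have hrq : K r ≤ K q := fun p hp => (hK q p).mpr fun v => by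
    have := (hK r p).mp hp (Fin.append v fun _ => ⟨1, hone⟩)
    rwa [torusWord_append, torusWord_const_one hone, mul_one] at this
  have heq : K r = K q := hrq.eq_of_not_lt (hmin _ ⟨r, rfl⟩)
  have hpr : p ∈ (K r).asIdeal := heq ▸ hp
  have := (hK r p).mp hpr (Fin.append (fun _ => ⟨1, hone⟩) v')
  rwa [torusWord_append, torusWord_const_one hone, one_mul] at this

/-- If a polynomial map takes all generic values on `exp 𝔥`, then the dimension of its target is
at most that of `𝔥`. -/
lemma le_finrank_of_forall_mem_range {n s : ℕ} (𝔥 : Submodule ℂ (Fin n → ℂ))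
    (P : Fin s → MvPolynomial (Fin n) ℂ) {f : MvPolynomial (Fin s) ℂ} (hf : f ≠ 0)
    (h : ∀ w, eval w f ≠ 0 → ∃ z ∈ 𝔥, ∀ k, eval (torusEmb n (expTorus n z)) (P k) = w k) :
    s ≤ Module.finrank ℂ 𝔥 := by
  by_contra! hlt
  let Y (z : 𝔥) (k : Fin s) : ℂ := eval (fun i => Complex.exp (z.1 i)) (P k)
  have hY : ContDiff ℝ 1 Y := by
    rw [contDiff_pi]
    intro k
    simp only [Y, MvPolynomial.eval_eq]
    have hcoord (i : Fin n) : ContDiff ℝ 1 fun z : 𝔥 => z.1 i :=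
      (((ContinuousLinearMap.proj (R := ℂ) (φ := fun _ : Fin n => ℂ) i).comp
        𝔥.subtypeL).restrictScalars ℝ).contDiff
    exact ContDiff.sum fun d _ => contDiff_const.mul
      (contDiff_prod fun i _ => ((hcoord i).cexp).pow _)
  have hdense := hY.dense_compl_range_of_finrank_lt_finrank (by
    rw [finrank_real_of_complex, finrank_real_of_complex, Module.finrank_fin_fun]
    omega)
  have hopen : IsOpen {w : Fin s → ℂ | eval w f ≠ 0} :=
    isOpen_ne_fun (MvPolynomial.continuous_eval f) continuous_const
  obtain ⟨w₀, hw₀⟩ : ∃ w, eval w f ≠ 0 := by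
    by_contra! h0
    exact hf (MvPolynomial.funext fun w => by rw [h0 w, map_zero])
  obtain ⟨w, hw, hwY⟩ := hdense.inter_open_nonempty _ hopen ⟨w₀, hw₀⟩
  obtain ⟨z, hz, hzw⟩ := h w hw
  exact hwY ⟨⟨z, hz⟩, funext hzw⟩

lemma closure_subset_image_expTorus {n : ℕ} {S : Set (Fin n → ℂˣ)}
    {𝔥 : Submodule ℂ (Fin n → ℂ)} (hsub : S ⊆ expTorus n '' (𝔥 : Set (Fin n → ℂ))) :
    ((Subgroup.closure S : Subgroup (Fin n → ℂˣ)) : Set (Fin n → ℂˣ)) ⊆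
      expTorus n '' (𝔥 : Set (Fin n → ℂ)) := by
  intro u hu
  induction hu using Subgroup.closure_induction with
  | mem x hx => exact hsub hx
  | one => exact ⟨0, 𝔥.zero_mem, funext fun i => Units.ext (by simp [expTorus])⟩
  | mul x y _ _ hx hy =>
    obtain ⟨a, ha, rfl⟩ := hx
    obtain ⟨b, hb, rfl⟩ := hy
    exact ⟨a + b, 𝔥.add_mem ha hb,
      funext fun i => Units.ext (by simp [expTorus, Complex.exp_add])⟩
  | inv x _ hx =>
    obtain ⟨a, ha, rfl⟩ := hx
    exact ⟨-a, 𝔥.neg_mem ha, funext fun i => Units.ext (by simp [expTorus, Complex.exp_neg])⟩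

theorem krullDim_generated_subgroup_le
    {n : ℕ} (S : Set (Fin n → ℂˣ)) (𝔥 : Submodule ℂ (Fin n → ℂ))
    (hone : (1 : Fin n → ℂˣ) ∈ S)
    (hirr : @IsIrreducible _ (torusTop n) S)
    (hclosed : @IsClosed _ (torusTop n) S)
    (hsub : S ⊆ expTorus n '' (𝔥 : Set (Fin n → ℂ))) :
    @topologicalKrullDim
        ((Subgroup.closure S : Subgroup (Fin n → ℂˣ)) : Set (Fin n → ℂˣ))
        (TopologicalSpace.induced
          (Subtype.val :
            ((Subgroup.closure S : Subgroup (Fin n → ℂˣ)) : Set (Fin n → ℂˣ)) → (Fin n → ℂˣ))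
          (torusTop n)) ≤ (Module.finrank ℂ 𝔥 : WithBot ℕ∞) := by
  let _ : TopologicalSpace S := TopologicalSpace.induced Subtype.val (torusTop n)
  let _ : TopologicalSpace ((Subgroup.closure S : Subgroup (Fin n → ℂˣ)) : Set (Fin n → ℂˣ)) :=
    TopologicalSpace.induced Subtype.val (torusTop n)
  have hSirr : IrreducibleSpace S := by
    let _ := torusTop n
    exact Subtype.irreducibleSpace hirr
  have hScl (p : MvPolynomial (Fin n) ℂ) : IsClosed {x : S | eval (torusEmb n x) p = 0} := by
    let _ := torusTop n
    exact (isClosed_eval_torusEmb_eq_zero p).preimage continuous_induced_dom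
  have hdom (N : ℕ) : IsDomain (torusPowAlg S N) := torusPowAlg.isDomain hScl
  obtain ⟨s, g, hg, hgint⟩ := exists_integral_inj_algHom_of_fg ℂ
    (torusPolyAlg ((Subgroup.closure S : Subgroup (Fin n → ℂˣ)) : Set (Fin n → ℂˣ)))
  refine (topologicalKrullDim_torus_le _).trans
    ((ringKrullDim_le_of_isIntegral g.toRingHom hgint).trans ?_)
  rw [MvPolynomial.ringKrullDim_of_isNoetherianRing, ringKrullDim_eq_zero_of_field, zero_add,
    Nat.card_eq_fintype_card, Fintype.card_fin]
  obtain ⟨N, ε, hinj⟩ := exists_injective_pullback hone hdom g hg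
  obtain ⟨f, hf, hlift⟩ := exists_generic_lift _ hinj
  refine Nat.cast_le.mpr (le_finrank_of_forall_mem_range 𝔥 (fun k => (g (X k)).2.choose) hf ?_)
  intro w hw
  obtain ⟨b, hb⟩ := hlift w hw
  obtain ⟨v, hv⟩ := torusPowAlg.exists_eq_apply hclosed b
  obtain ⟨z, hz, hzv⟩ := closure_subset_image_expTorus hsub (torusWord ε v).2
  refine ⟨z, hz, fun k => ?_⟩
  rw [← hb k, hv]
  have h1 := congrFun (g (X k)).2.choose_spec (torusWord ε v)
  refine Eq.trans ?_ h1
  refine Eq.trans ?_ (aeval_torus_apply _ _).symm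
  rw [← hzv]
end
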